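/- Let V be a finite type, L : List V → (V → ℝ) a logits function, G ⊆ V, δ ≥ 0, and n ≥ 1. Define the sequence distribution P on V^n by P(y_1,…,y_n) = ∏_{t=1}^n softmax(L(y_1,…,y_{t−1}))(y_t), and the watermarked sequence distribution P̂ on V^n by P̂(y_1,…,y_n) = ∏_{t=1}^n softmax( L(y_1,…,y_{t−1}) + δ·1_G )(y_t). Then ∑_{y ∈ V^n} P̂(y)·log( P̂(y)/P(y) ) ≤ n·min(δ, δ²/8), and likewise ∑_{y ∈ V^n} P(y)·log( P(y)/P̂(y) ) ≤ n·min(δ, δ²/8). -/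

import Mathlib

open scoped BigOperators

/-- The softmax distribution associated to a vector of logits. -/
noncomputable def softmax {V : Type*} [Fintype V] (l : V → ℝ) (v : V) : ℝ :=
  Real.exp (l v) / ∑ w, Real.exp (l w)

/-- The watermarked logits: add `δ` to the logits of the tokens in the green list `G`. -/
def wmLogits {V : Type*} [DecidableEq V] (l : V → ℝ) (G : Finset V) (δ : ℝ) (v : V) : ℝ :=
  l v + if v ∈ G then δ else 0

/-- The distribution over length-`n` sequences induced by a family of per-step
conditional distributions `q` (indexed by the prefix). -/
noncomputable def seqProb {V : Type*} (q : List V → V → ℝ) (n : ℕ) (y : Fin n → V) : ℝ :=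
  ∏ t : Fin n, q ((List.ofFn y).take t) (y t)

/-- Hoeffding's lemma for a Bernoulli variable. -/
theorem bernoulli_mgf_le {p : ℝ} (h0 : 0 ≤ p) (h1 : p ≤ 1) (δ : ℝ) :
    1 - p + p * Real.exp δ ≤ Real.exp (δ * p + δ ^ 2 / 8) := by
  let μ : MeasureTheory.Measure ℝ :=
    ENNReal.ofReal (1 - p) • MeasureTheory.Measure.dirac 0 +
      ENNReal.ofReal p • MeasureTheory.Measure.dirac 1
  have hμ : MeasureTheory.IsProbabilityMeasure μ := by
    constructor
    simp only [μ, MeasureTheory.Measure.add_apply, MeasureTheory.Measure.smul_apply,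
      MeasureTheory.measure_univ, smul_eq_mul, mul_one]
    rw [← ENNReal.ofReal_add (by linarith) h0]
    simp
  have hint (f : ℝ → ℝ) : ∫ x, f x ∂μ = (1 - p) * f 0 + p * f 1 := by
    have hi (c a : ℝ) : MeasureTheory.Integrable f
        (ENNReal.ofReal c • MeasureTheory.Measure.dirac a) :=
      (MeasureTheory.integrable_dirac (by simp)).smul_measure ENNReal.ofReal_ne_top
    simp only [μ]
    rw [MeasureTheory.integral_add_measure (hi _ _) (hi _ _),
      MeasureTheory.integral_smul_measure, MeasureTheory.integral_smul_measure,
      MeasureTheory.integral_dirac, MeasureTheory.integral_dirac,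
      ENNReal.toReal_ofReal (by linarith), ENNReal.toReal_ofReal h0, smul_eq_mul, smul_eq_mul]
  have hb : ∀ᵐ x ∂μ, x ∈ Set.Icc (0 : ℝ) 1 := by
    simp only [μ, MeasureTheory.ae_add_measure_iff]
    constructor <;> refine MeasureTheory.Measure.ae_smul_measure ?_ _ <;>
      simp [MeasureTheory.ae_dirac_eq]
  have key := (ProbabilityTheory.hasSubgaussianMGF_of_mem_Icc
    (X := fun x : ℝ => x) aemeasurable_id hb).mgf_le δ
  simp only [ProbabilityTheory.mgf, hint] at key
  norm_num at key
  have e1 : Real.exp (δ * (1 - p)) = Real.exp δ * Real.exp (-(δ * p)) := by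
    rw [← Real.exp_add]; ring_nf
  have e2 : Real.exp (δ * p + δ ^ 2 / 8) = Real.exp (δ ^ 2 / 8) * Real.exp (δ * p) := by
    rw [← Real.exp_add]; ring_nf
  have e3 : Real.exp (-(δ * p)) * Real.exp (δ * p) = 1 := by
    rw [← Real.exp_add]; simp
  have key' : (1 - p) * Real.exp (-(δ * p)) + p * Real.exp (δ * (1 - p)) ≤
      Real.exp (δ ^ 2 / 8) := by
    convert key using 2
    ring
  rw [e2]
  rw [e1] at key'
  have := mul_le_mul_of_nonneg_right key' (Real.exp_pos (δ * p)).le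
  linear_combination this - (1 - p + p * Real.exp δ) * e3

theorem softmax_pos {V : Type*} [Fintype V] [Nonempty V] (l : V → ℝ) (v : V) :
    0 < softmax l v :=
  div_pos (Real.exp_pos _) (Finset.sum_pos (fun _ _ => Real.exp_pos _) Finset.univ_nonempty)

theorem sum_softmax {V : Type*} [Fintype V] [Nonempty V] (l : V → ℝ) :
    ∑ v, softmax l v = 1 := by
  have h : 0 < ∑ w, Real.exp (l w) :=
    Finset.sum_pos (fun _ _ => Real.exp_pos _) Finset.univ_nonempty
  simp only [softmax]
  rw [← Finset.sum_div, div_self h.ne']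

/-- The log-likelihood ratio of the unwatermarked and the watermarked softmax. -/
theorem log_softmax_div_wmLogits {V : Type*} [Fintype V] [Nonempty V] [DecidableEq V]
    (l : V → ℝ) (G : Finset V) (δ : ℝ) (v : V) :
    Real.log (softmax l v / softmax (wmLogits l G δ) v) =
      Real.log (∑ w, softmax l w * Real.exp (if w ∈ G then δ else 0)) -
        if v ∈ G then δ else 0 := by
  have h : 0 < ∑ w, Real.exp (l w) :=
    Finset.sum_pos (fun _ _ => Real.exp_pos _) Finset.univ_nonempty
  have h' : 0 < ∑ w, Real.exp (wmLogits l G δ w) :=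
    Finset.sum_pos (fun _ _ => Real.exp_pos _) Finset.univ_nonempty
  have hs : ∑ w, softmax l w * Real.exp (if w ∈ G then δ else 0) =
      (∑ w, Real.exp (wmLogits l G δ w)) / ∑ w, Real.exp (l w) := by
    rw [Finset.sum_div]
    refine Finset.sum_congr rfl fun w _ => ?_
    rw [wmLogits, Real.exp_add, softmax]
    ring
  rw [hs, Real.log_div (softmax_pos _ _).ne' (softmax_pos _ _).ne', softmax, softmax,
    Real.log_div (Real.exp_pos _).ne' h.ne', Real.log_div (Real.exp_pos _).ne' h'.ne',
    Real.log_div h'.ne' h.ne', Real.log_exp, Real.log_exp, wmLogits]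
  ring

/-- Shifting the logits on a green list by `δ`, of either sign, moves the softmax by at most
`min |δ| (δ ^ 2 / 8)` in Kullback–Leibler divergence. -/
theorem softmax_kl_wmLogits_le {V : Type*} [Fintype V] [Nonempty V] [DecidableEq V]
    (l : V → ℝ) (G : Finset V) (δ : ℝ) :
    ∑ v, softmax l v * Real.log (softmax l v / softmax (wmLogits l G δ) v) ≤
      min |δ| (δ ^ 2 / 8) := by
  set p := ∑ v ∈ G, softmax l v with hp
  have h0 : 0 ≤ p := Finset.sum_nonneg fun v _ => (softmax_pos l v).le
  have h1 : p ≤ 1 := by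
    rw [← sum_softmax l]
    exact Finset.sum_le_sum_of_subset_of_nonneg (Finset.subset_univ _)
      fun v _ _ => (softmax_pos l v).le
  have hite (c : ℝ) : ∑ v, softmax l v * (if v ∈ G then c else 0) = p * c := by
    simp [hp, Finset.sum_mul]
  have hM : ∑ w, softmax l w * Real.exp (if w ∈ G then δ else 0) = 1 - p + p * Real.exp δ := by
    have (w : V) : softmax l w * Real.exp (if w ∈ G then δ else 0) =
        softmax l w + softmax l w * (if w ∈ G then Real.exp δ - 1 else 0) := by
      split_ifs
      · ring
      · simp
    simp only [this, Finset.sum_add_distrib, hite, sum_softmax]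
    ring
  have hMpos : 0 < 1 - p + p * Real.exp δ := by
    rw [← hM]
    exact Finset.sum_pos (fun w _ => mul_pos (softmax_pos l w) (Real.exp_pos _))
      Finset.univ_nonempty
  have hkl : ∑ v, softmax l v * Real.log (softmax l v / softmax (wmLogits l G δ) v) =
      Real.log (1 - p + p * Real.exp δ) - p * δ := by
    simp only [log_softmax_div_wmLogits, mul_sub, Finset.sum_sub_distrib, hite,
      ← Finset.sum_mul, sum_softmax, hM, one_mul]
  rw [hkl]
  refine le_min ?_ ?_
  · rcases le_total 0 δ with hδ | hδ
    · have hM' : 1 - p + p * Real.exp δ ≤ Real.exp δ := by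
        nlinarith [Real.one_le_exp hδ]
      have := (Real.log_le_iff_le_exp hMpos).2 hM'
      rw [abs_of_nonneg hδ]
      nlinarith
    · have hM' : 1 - p + p * Real.exp δ ≤ Real.exp 0 := by
        rw [Real.exp_zero]
        nlinarith [Real.exp_le_one_iff.2 hδ]
      have := (Real.log_le_iff_le_exp hMpos).2 hM'
      rw [abs_of_nonpos hδ]
      nlinarith
  · have := (Real.log_le_iff_le_exp hMpos).2 (bernoulli_mgf_le h0 h1 δ)
    linarith

theorem wmLogits_wmLogits_neg {V : Type*} [DecidableEq V] (l : V → ℝ) (G : Finset V) (δ : ℝ) :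
    wmLogits (wmLogits l G δ) G (-δ) = l := by
  funext v
  simp only [wmLogits]
  split_ifs <;> ring

theorem seqProb_cons {V : Type*} (q : List V → V → ℝ) (n : ℕ) (a : V) (y : Fin n → V) :
    seqProb q (n + 1) (Fin.cons a y) = q [] a * seqProb (fun h => q (a :: h)) n y := by
  simp [seqProb, Fin.prod_univ_succ, List.ofFn_succ]

theorem sum_fin_succ_fun {V : Type*} [Fintype V] (n : ℕ) (f : (Fin (n + 1) → V) → ℝ) :
    ∑ y, f y = ∑ a, ∑ y : Fin n → V, f (Fin.cons a y) := by
  rw [← (Fin.consEquiv fun _ : Fin (n + 1) => V).sum_comp, Fintype.sum_prod_type]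
  rfl

theorem seqProb_pos {V : Type*} {q : List V → V → ℝ} (hq : ∀ h v, 0 < q h v) (n : ℕ)
    (y : Fin n → V) : 0 < seqProb q n y :=
  Finset.prod_pos fun _ _ => hq _ _

theorem sum_seqProb {V : Type*} [Fintype V] {q : List V → V → ℝ}
    (hq : ∀ h, ∑ v, q h v = 1) (n : ℕ) : ∑ y, seqProb q n y = 1 := by
  induction n generalizing q with
  | zero => simp [seqProb]
  | succ n ih =>
    rw [sum_fin_succ_fun]
    simp only [seqProb_cons, ← Finset.mul_sum]
    simp [ih fun h => hq _, hq]

/-- Chain rule: a uniform bound on the conditional Kullback–Leibler divergences adds up along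
a sequence. -/
theorem seqProb_kl_le {V : Type*} [Fintype V] {q r : List V → V → ℝ} {c : ℝ}
    (hq : ∀ h v, 0 < q h v) (hr : ∀ h v, 0 < r h v) (hq1 : ∀ h, ∑ v, q h v = 1)
    (hc : ∀ h, ∑ v, q h v * Real.log (q h v / r h v) ≤ c) (n : ℕ) :
    ∑ y, seqProb q n y * Real.log (seqProb q n y / seqProb r n y) ≤ n * c := by
  induction n generalizing q r with
  | zero => simp [seqProb]
  | succ n ih =>
    have hstep (a : V) (y : Fin n → V) :
        seqProb q (n + 1) (Fin.cons a y) *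
          Real.log (seqProb q (n + 1) (Fin.cons a y) / seqProb r (n + 1) (Fin.cons a y)) =
        q [] a * Real.log (q [] a / r [] a) * seqProb (fun h => q (a :: h)) n y +
          q [] a * (seqProb (fun h => q (a :: h)) n y *
            Real.log (seqProb (fun h => q (a :: h)) n y / seqProb (fun h => r (a :: h)) n y)) := by
      have hQ := seqProb_pos (fun h => hq (a :: h)) n y
      have hR := seqProb_pos (fun h => hr (a :: h)) n y
      rw [seqProb_cons, seqProb_cons, mul_div_mul_comm,
        Real.log_mul (div_pos (hq _ _) (hr _ _)).ne' (div_pos hQ hR).ne']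
      ring
    rw [sum_fin_succ_fun]
    simp only [hstep, Finset.sum_add_distrib, ← Finset.mul_sum]
    have htail : ∑ a, q [] a * ∑ y, seqProb (fun h => q (a :: h)) n y *
        Real.log (seqProb (fun h => q (a :: h)) n y / seqProb (fun h => r (a :: h)) n y) ≤
        ∑ a, q [] a * (n * c) :=
      Finset.sum_le_sum fun a _ => mul_le_mul_of_nonneg_left
        (ih (fun h => hq _) (fun h => hr _) (fun h => hq1 _) fun h => hc _) (hq _ _).le
    rw [← Finset.sum_mul, hq1, one_mul] at htail
    have hhead : ∑ a, q [] a * Real.log (q [] a / r [] a) *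
        ∑ y, seqProb (fun h => q (a :: h)) n y ≤ c := by
      simpa [sum_seqProb fun h => hq1 (_ :: h)] using hc []
    push_cast
    linarith

/-- **KL-divergence bound for length-`n` sequences.**  The KL divergence (in both
directions) between the watermarked sequence distribution `P̂` and the original
sequence distribution `P` over `V^n` is at most `n · min(δ, δ²/8)`. -/
theorem watermark_sequence_kl_bound {V : Type*} [Fintype V] [Nonempty V] [DecidableEq V]
    (L : List V → V → ℝ) (G : Finset V) (δ : ℝ) (hδ : 0 ≤ δ) (n : ℕ) (hn : 1 ≤ n) :
    (∑ y : Fin n → V,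
        seqProb (fun h => softmax (wmLogits (L h) G δ)) n y *
          Real.log (seqProb (fun h => softmax (wmLogits (L h) G δ)) n y /
            seqProb (fun h => softmax (L h)) n y) ≤ (n : ℝ) * min δ (δ ^ 2 / 8)) ∧
      (∑ y : Fin n → V,
        seqProb (fun h => softmax (L h)) n y *
          Real.log (seqProb (fun h => softmax (L h)) n y /
            seqProb (fun h => softmax (wmLogits (L h) G δ)) n y) ≤
          (n : ℝ) * min δ (δ ^ 2 / 8)) := by
  refine ⟨seqProb_kl_le (fun _ => softmax_pos _) (fun _ => softmax_pos _)
      (fun _ => sum_softmax _) (fun h => ?_) n,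
    seqProb_kl_le (fun _ => softmax_pos _) (fun _ => softmax_pos _)
      (fun _ => sum_softmax _) (fun h => ?_) n⟩
  · simpa [wmLogits_wmLogits_neg, abs_of_nonneg hδ] using
      softmax_kl_wmLogits_le (wmLogits (L h) G δ) G (-δ)
  · simpa [abs_of_nonneg hδ] using softmax_kl_wmLogits_le (L h) G δ
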